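/- For every t > 0, the identity t ∫_0^1 (1−z)(1 − e^{−tz}) / z dz + (1/2)(t − 1 + e^{−t}) = t ln t + t (γ − 1/2 + E₁(t)) + (1/2)(1 − e^{−t}) holds, where γ is the Euler–Mascheroni constant and E₁(t) = ∫_t^∞ s^{-1} e^{−s} ds. (Both sides equal the covariance Cov(Σ₀(t), Σ₁(t)) of the sums of the spherical intrinsic volumes V₀ and V₁ over all cells of an isotropic splitting tessellation on S² with time parameter t, which is therefore asymptotically equivalent to t ln t as t → ∞.) -/

import Mathlib

open MeasureTheory Real

/-- The exponential integral `E₁(t) = ∫_t^∞ s⁻¹ e^{-s} ds`. -/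
noncomputable def expIntegralE1 (t : ℝ) : ℝ := ∫ s in Set.Ioi t, s⁻¹ * Real.exp (-s)

open Set Filter Topology Asymptotics

/-- The derivative of the Gamma integral at `1`: `∫_0^∞ log s e^{-s} ds = -γ`. -/
theorem integral_log_mul_exp_neg :
    ∫ s in Ioi (0 : ℝ), log s * exp (-s) = -eulerMascheroniConstant := by
  have hint := Complex.hasDerivAt_GammaIntegral (s := 1) (by simp)
  have hGamma : HasDerivAt Complex.GammaIntegral (-(eulerMascheroniConstant : ℂ)) 1 := by
    refine Complex.hasDerivAt_Gamma_one.congr_of_eventuallyEq ?_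
    have hopen : IsOpen {s : ℂ | 0 < s.re} := isOpen_Ioi.preimage Complex.continuous_re
    filter_upwards [hopen.mem_nhds (show (1 : ℂ) ∈ {s : ℂ | 0 < s.re} by simp)] with s hs
    exact (Complex.Gamma_eq_integral hs).symm
  have huniq := hint.unique hGamma
  simp only [sub_self, Complex.cpow_zero, one_mul, ← Complex.ofReal_mul] at huniq
  rw [integral_complex_ofReal] at huniq
  exact_mod_cast huniq

/-- The continuous extension of `s ↦ (1 - e^{-s}) / s` to the real line. -/
noncomputable def oneSubExpNegDiv : ℝ → ℝ := dslope (fun s => -exp (-s)) 0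

theorem continuous_oneSubExpNegDiv : Continuous oneSubExpNegDiv := by
  rw [← continuousOn_univ, oneSubExpNegDiv, continuousOn_dslope univ_mem]
  exact ⟨by fun_prop, by fun_prop⟩

theorem mul_oneSubExpNegDiv (s : ℝ) : s * oneSubExpNegDiv s = 1 - exp (-s) := by
  have h := sub_smul_dslope (fun s : ℝ => -exp (-s)) 0 s
  simp only [sub_zero, smul_eq_mul, neg_zero, exp_zero] at h
  rw [oneSubExpNegDiv, h]
  ring

theorem isBigO_mul_exp_neg {f : ℝ → ℝ} (hf : f =O[atTop] (id : ℝ → ℝ)) :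
    (fun s => f s * exp (-s)) =O[atTop] fun s => exp (-(1 / 2) * s) := by
  have hpow := (isLittleO_pow_exp_pos_mul_atTop 1 (b := 1 / 2) (by norm_num)).isBigO
  simp only [pow_one] at hpow
  refine ((hf.trans hpow).mul (isBigO_refl (fun s : ℝ => exp (-s)) atTop)).congr_right ?_
  intro s
  rw [← exp_add]
  ring_nf

theorem isBigO_log_mul_exp_neg :
    (fun s => log s * exp (-s)) =O[atTop] fun s => exp (-(1 / 2) * s) :=
  isBigO_mul_exp_neg isLittleO_log_id_atTop.isBigO

theorem integrableOn_log_mul_exp_neg {t : ℝ} (ht : 0 < t) :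
    IntegrableOn (fun s => log s * exp (-s)) (Ioi t) := by
  refine integrable_of_isBigO_exp_neg (b := 1 / 2) (by norm_num) ?_ isBigO_log_mul_exp_neg
  exact (continuousOn_log.mono fun s hs => (ht.trans_le hs).ne').mul (by fun_prop)

theorem integrableOn_inv_mul_exp_neg {t : ℝ} (ht : 0 < t) :
    IntegrableOn (fun s => s⁻¹ * exp (-s)) (Ioi t) := by
  refine integrable_of_isBigO_exp_neg (b := 1 / 2) (by norm_num) ?_ (isBigO_mul_exp_neg ?_)
  · exact (continuousOn_inv₀.mono fun s hs => (ht.trans_le hs).ne').mul (by fun_prop)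
  · refine IsBigO.of_bound 1 ?_
    filter_upwards [eventually_ge_atTop 1] with s hs
    simp only [norm_inv, id_eq, one_mul, Real.norm_eq_abs, abs_of_pos (one_pos.trans_le hs)]
    exact (inv_le_one_of_one_le₀ hs).trans hs

theorem integral_Ioi_log_mul_exp_neg {t : ℝ} (ht : 0 < t) :
    ∫ s in Ioi t, log s * exp (-s) = log t * exp (-t) + expIntegralE1 t := by
  have hI := integrableOn_log_mul_exp_neg ht
  have hJ := integrableOn_inv_mul_exp_neg ht
  have hlim : Tendsto (fun s => -(log s * exp (-s))) atTop (𝓝 0) := by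
    have hexp : Tendsto (fun s : ℝ => exp (-(1 / 2) * s)) atTop (𝓝 0) :=
      tendsto_exp_atBot.comp (tendsto_id.const_mul_atTop_of_neg (by norm_num))
    simpa using (isBigO_log_mul_exp_neg.trans_tendsto hexp).neg
  have hderiv : ∀ s ∈ Ici t, HasDerivAt (fun s => -(log s * exp (-s)))
      (log s * exp (-s) - s⁻¹ * exp (-s)) s := by
    intro s hs
    have h := ((hasDerivAt_log (ht.trans_le hs).ne').mul (hasDerivAt_neg s).exp).neg
    convert! h using 1
    ring
  have h := integral_Ioi_of_hasDerivAt_of_tendsto' hderiv (hI.sub hJ) hlim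
  rw [integral_sub hI hJ] at h
  rw [expIntegralE1]
  linarith

theorem intervalIntegrable_log_mul_exp_neg (a b : ℝ) :
    IntervalIntegrable (fun s => log s * exp (-s)) volume a b :=
  intervalIntegral.intervalIntegrable_log'.mul_continuousOn (by fun_prop)

theorem integral_zero_log_mul_exp_neg {t : ℝ} (ht : 0 < t) :
    ∫ s in (0 : ℝ)..t, log s * exp (-s)
      = log t * (1 - exp (-t)) - ∫ s in (0 : ℝ)..t, oneSubExpNegDiv s := by
  have hI := intervalIntegrable_log_mul_exp_neg 0 t
  have hJ := continuous_oneSubExpNegDiv.intervalIntegrable (μ := volume) 0 t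
  have hcont : Continuous fun s => log s * (1 - exp (-s)) := by
    have h := continuous_mul_log.mul continuous_oneSubExpNegDiv
    refine h.congr fun s => ?_
    rw [Pi.mul_apply, ← mul_oneSubExpNegDiv]
    ring
  have hderiv : ∀ s ∈ Ioo 0 t, HasDerivAt (fun s => log s * (1 - exp (-s)))
      (log s * exp (-s) + oneSubExpNegDiv s) s := by
    intro s hs
    have h := (hasDerivAt_log hs.1.ne').mul ((hasDerivAt_neg s).exp.const_sub 1)
    convert! h using 1
    rw [← mul_oneSubExpNegDiv, inv_mul_cancel_left₀ hs.1.ne']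
    ring
  have h := intervalIntegral.integral_eq_sub_of_hasDerivAt_of_le ht.le hcont.continuousOn hderiv
    (hI.add hJ)
  rw [intervalIntegral.integral_add hI hJ] at h
  simp only [log_zero, zero_mul, sub_zero] at h
  linarith

/-- The complementary exponential integral: `∫_0^t (1 - e^{-s})/s ds = log t + γ + E₁(t)`. -/
theorem integral_oneSubExpNegDiv {t : ℝ} (ht : 0 < t) :
    ∫ s in (0 : ℝ)..t, oneSubExpNegDiv s
      = log t + eulerMascheroniConstant + expIntegralE1 t := by
  have hI := (intervalIntegrable_iff_integrableOn_Ioc_of_le ht.le).1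
    (intervalIntegrable_log_mul_exp_neg 0 t)
  have hsplit := setIntegral_union Ioc_disjoint_Ioi_same measurableSet_Ioi hI
    (integrableOn_log_mul_exp_neg ht)
  rw [Ioc_union_Ioi_eq_Ioi ht.le, integral_log_mul_exp_neg, integral_Ioi_log_mul_exp_neg ht,
    ← intervalIntegral.integral_of_le ht.le, integral_zero_log_mul_exp_neg ht] at hsplit
  linarith

theorem integral_one_sub_exp_neg_mul {t : ℝ} (ht : t ≠ 0) :
    ∫ z in (0 : ℝ)..1, (1 - exp (-(t * z))) = 1 - (1 - exp (-t)) / t := by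
  have hderiv : ∀ z ∈ uIcc (0 : ℝ) 1,
      HasDerivAt (fun z => z + exp (-(t * z)) / t) (1 - exp (-(t * z))) z := by
    intro z _
    have h := (hasDerivAt_id z).add ((((hasDerivAt_id z).const_mul t).neg.exp).div_const t)
    convert! h using 1
    simp only [id_eq, Pi.neg_apply]
    field_simp
    ring
  rw [intervalIntegral.integral_eq_sub_of_hasDerivAt hderiv
    (Continuous.intervalIntegrable (by fun_prop) _ _)]
  simp only [mul_one, mul_zero, neg_zero, exp_zero]
  ring

theorem integral_one_sub_mul_one_sub_exp_neg_div {t : ℝ} (ht : t ≠ 0) :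
    ∫ z in (0 : ℝ)..1, (1 - z) * (1 - exp (-(t * z))) / z
      = (∫ s in (0 : ℝ)..t, oneSubExpNegDiv s) - (1 - (1 - exp (-t)) / t) := by
  have hcongr : ∫ z in (0 : ℝ)..1, (1 - z) * (1 - exp (-(t * z))) / z
      = ∫ z in (0 : ℝ)..1, (t * oneSubExpNegDiv (t * z) - (1 - exp (-(t * z)))) := by
    refine intervalIntegral.integral_congr_ae (ae_of_all _ fun z hz => ?_)
    rw [uIoc_of_le zero_le_one] at hz
    have hz0 : z ≠ 0 := hz.1.ne'
    rw [← mul_oneSubExpNegDiv]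
    field_simp
  have hcont : Continuous fun z => t * oneSubExpNegDiv (t * z) :=
    continuous_const.mul (continuous_oneSubExpNegDiv.comp (by fun_prop))
  rw [hcongr, intervalIntegral.integral_sub (hcont.intervalIntegrable _ _)
    (Continuous.intervalIntegrable (by fun_prop) _ _), integral_one_sub_exp_neg_mul ht,
    intervalIntegral.integral_const_mul, intervalIntegral.mul_integral_comp_mul_left]
  simp only [mul_zero, mul_one]

/-- For every `t > 0`,
`t ∫_0^1 (1-z)(1-e^{-tz})/z dz + (1/2)(t - 1 + e^{-t})
  = t ln t + t(γ - 1/2 + E₁(t)) + (1/2)(1 - e^{-t})`;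
both sides equal the covariance `Cov(Σ₀(t), Σ₁(t))` for an isotropic splitting tessellation
on `S²`. -/
theorem covSigma0Sigma1_identity (t : ℝ) (ht : 0 < t) :
    t * (∫ z in (0:ℝ)..1, (1 - z) * (1 - Real.exp (-(t * z))) / z)
        + (1 / 2) * (t - 1 + Real.exp (-t))
      = t * Real.log t
        + t * (Real.eulerMascheroniConstant - 1 / 2 + expIntegralE1 t)
        + (1 / 2) * (1 - Real.exp (-t)) := by
  rw [integral_one_sub_mul_one_sub_exp_neg_div ht.ne', integral_oneSubExpNegDiv ht]
  field_simp
  ring
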